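/- arXiv:math/0407269 — 4 statements merged into one kernel-verified Lean document; each statement's English description precedes it below -/
import Mathlib

section
/- Let Φ be the map sending a quintuple of integers (a, j, k, m, b) with a + m ≡ 0 (mod 3) to the quintuple (c₄, c₁c₃, c₂², c₁²c₂, c₁⁴) defined by c₄ = a, c₁c₃ = 4m + 2a, c₁⁴ = b, c₁²c₂ = 12k − 2b, and c₂² = (720j − a − 4m − 48k + 9b)/3. Then Φ is well defined (i.e. 3 divides 720j − a − 4m − 48k + 9b) and is a bijection from the set {(a, j, k, m, b) ∈ ℤ⁵ : a + m ≡ 0 (mod 3)} onto the set of admissible quintuples. -/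
/-- A quintuple of integers `(c₄, c₁c₃, c₂², c₁²c₂, c₁⁴)` is admissible if it satisfies
the three congruence relations coming from the Riemann-Roch theorem in dimension 8. -/
def Admissible (c : ℤ × ℤ × ℤ × ℤ × ℤ) : Prop :=
  (720 : ℤ) ∣ (-c.1 + c.2.1 + 3 * c.2.2.1 + 4 * c.2.2.2.1 - c.2.2.2.2) ∧
  (12 : ℤ) ∣ (2 * c.2.2.2.2 + c.2.2.2.1) ∧
  (4 : ℤ) ∣ (-2 * c.1 + c.2.1)

/-- The map Φ sending `(a, j, k, m, b)` with `a + m ≡ 0 (mod 3)` to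
`(c₄, c₁c₃, c₂², c₁²c₂, c₁⁴)` is well defined and a bijection onto the admissible
quintuples. -/
theorem phi_bijection :
    (∀ a j k m b : ℤ, (3 : ℤ) ∣ (a + m) →
      (3 : ℤ) ∣ (720 * j - a - 4 * m - 48 * k + 9 * b)) ∧
    Set.BijOn
      (fun p : ℤ × ℤ × ℤ × ℤ × ℤ =>
        (p.1, 4 * p.2.2.2.1 + 2 * p.1,
          (720 * p.2.1 - p.1 - 4 * p.2.2.2.1 - 48 * p.2.2.1 + 9 * p.2.2.2.2) / 3,
          12 * p.2.2.1 - 2 * p.2.2.2.2, p.2.2.2.2))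
      {p : ℤ × ℤ × ℤ × ℤ × ℤ | (3 : ℤ) ∣ (p.1 + p.2.2.2.1)}
      {c : ℤ × ℤ × ℤ × ℤ × ℤ | Admissible c} := by
  refine ⟨fun a j k m b h => by omega, ?_, ?_, ?_⟩
  · rintro ⟨a, j, k, m, b⟩ h
    simp only [Set.mem_ofPred_eq, Admissible] at h ⊢
    omega
  · rintro ⟨a, j, k, m, b⟩ h ⟨a', j', k', m', b'⟩ h' heq
    simp only [Set.mem_ofPred_eq, Prod.mk.injEq] at h h' heq ⊢
    omega
  · rintro ⟨x, y, z, w, b⟩ ⟨⟨j, hj⟩, ⟨k, hk⟩, ⟨m, hm⟩⟩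
    simp only at hj hk hm
    refine ⟨(x, j, k, m, b), ?_, ?_⟩
    · simp only [Set.mem_ofPred_eq]
      omega
    · refine Prod.ext rfl (Prod.ext ?_ (Prod.ext ?_ (Prod.ext ?_ rfl))) <;> dsimp only <;> omega
end

section
/- Fix an integer n. For all integers a', m', k', b', the system of linear equations 3x + 4y − 4z + (12n+3)u = a' − 48n − 12, −4y + 4z − (36n+12)u = 4m' + 12, −180x − 108y + 144z + (36n+60)u = 12k' + 192n + 468, −81x − 48y + 64z + (24n+30)u = b' + 128n + 208 has a solution (x, y, z, u) in integers if and only if a' + m' ≡ 0 (mod 3); moreover, when a solution in integers exists it is unique. -/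
/-- The blow-up system for `j = n ≥ 1` has an integer solution `(x, y, z, u)` if and
only if `a' + m' ≡ 0 (mod 3)`, and when a solution exists it is unique. -/
theorem blowup_system_solvable_iff (n : ℤ) (a' m' k' b' : ℤ) :
    ((∃ x y z u : ℤ,
        3 * x + 4 * y - 4 * z + (12 * n + 3) * u = a' - 48 * n - 12 ∧
        -4 * y + 4 * z - (36 * n + 12) * u = 4 * m' + 12 ∧
        -180 * x - 108 * y + 144 * z + (36 * n + 60) * u = 12 * k' + 192 * n + 468 ∧
        -81 * x - 48 * y + 64 * z + (24 * n + 30) * u = b' + 128 * n + 208) ↔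
      (3 : ℤ) ∣ (a' + m')) ∧
    (∀ x y z u x₁ y₁ z₁ u₁ : ℤ,
      (3 * x + 4 * y - 4 * z + (12 * n + 3) * u = a' - 48 * n - 12 ∧
       -4 * y + 4 * z - (36 * n + 12) * u = 4 * m' + 12 ∧
       -180 * x - 108 * y + 144 * z + (36 * n + 60) * u = 12 * k' + 192 * n + 468 ∧
       -81 * x - 48 * y + 64 * z + (24 * n + 30) * u = b' + 128 * n + 208) →
      (3 * x₁ + 4 * y₁ - 4 * z₁ + (12 * n + 3) * u₁ = a' - 48 * n - 12 ∧
       -4 * y₁ + 4 * z₁ - (36 * n + 12) * u₁ = 4 * m' + 12 ∧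
       -180 * x₁ - 108 * y₁ + 144 * z₁ + (36 * n + 60) * u₁ = 12 * k' + 192 * n + 468 ∧
       -81 * x₁ - 48 * y₁ + 64 * z₁ + (24 * n + 30) * u₁ = b' + 128 * n + 208) →
      x = x₁ ∧ y = y₁ ∧ z = z₁ ∧ u = u₁) := by
  refine ⟨⟨?_, ?_⟩, ?_⟩
  · rintro ⟨x, y, z, u, h₁, h₂, -, -⟩
    exact ⟨x - (8 * n + 3) * u + 16 * n - m', by linear_combination -h₁ - h₂⟩
  · rintro ⟨t, ht⟩
    obtain rfl : a' = 3 * t - m' := by linarith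
    -- Eliminating `x` and `z` leaves a unimodular system in `y` and `u`,
    -- whose right-hand sides are `r` and `s`.
    obtain ⟨r, hr⟩ : ∃ r, r = k' - 224 * n + 3 + 15 * (t + m') - 12 * m' := ⟨_, rfl⟩
    obtain ⟨s, hs⟩ : ∃ s, s = b' - 1168 * n + 16 + 81 * (t + m') - 64 * m' := ⟨_, rfl⟩
    obtain ⟨y, hy⟩ : ∃ y, y = -(48 * n + 21) * r + (9 * n + 4) * s := ⟨_, rfl⟩
    obtain ⟨u, hu⟩ : ∃ u, u = 3 * s - 16 * r := ⟨_, rfl⟩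
    have hyr : 3 * y - (9 * n + 4) * u = r := by rw [hy, hu]; ring
    have hys : 16 * y - (48 * n + 21) * u = s := by rw [hy, hu]; ring
    refine ⟨(8 * n + 3) * u + t + m' - 16 * n, y, y + (9 * n + 3) * u + m' + 3, u,
      by ring, by ring, ?_, ?_⟩
    · linear_combination 12 * hyr + 12 * hr
    · linear_combination hys + hs
  · rintro x y z u x₁ y₁ z₁ u₁ ⟨h₁, h₂, h₃, h₄⟩ ⟨g₁, g₂, g₃, g₄⟩
    have hu : 3 * u = 3 * u₁ := by
      linear_combination 3 * (h₁ - g₁) + 3 * (h₂ - g₂) - 4 * (h₃ - g₃) + 9 * (h₄ - g₄)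
    obtain rfl : u = u₁ := by linarith
    refine ⟨?_, ?_, ?_, rfl⟩ <;> linarith
end

section
/- Fix an integer n and let a', m', k', b' be integers with a' + m' ≡ 0 (mod 3). Define x = ((24n+10)a' + (96n+40)m')/3 + (−128n−48)k' + (24n+9)b' + 640n² + 224n, y = (3n+3)a' + (12n+8)m' + (−48n−21)k' + (9n+4)b' + 240n² + 32n + 1, z = (12n+6)a' + (48n+21)m' + (−192n−69)k' + (36n+13)b' + 960n² + 272n + 4, and u = a' + 4m' − 16k' + 3b' + 80n. Then x is an integer, and (x, y, z, u) satisfies the four equations 3x + 4y − 4z + (12n+3)u = a' − 48n − 12, −4y + 4z − (36n+12)u = 4m' + 12, −180x − 108y + 144z + (36n+60)u = 12k' + 192n + 468, and −81x − 48y + 64z + (24n+30)u = b' + 128n + 208. -/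
/-- The explicit integer solution of the blow-up system for `j = n ≥ 1`. -/
theorem blowup_system_explicit_solution (n a' m' k' b' : ℤ)
    (h : (3 : ℤ) ∣ (a' + m')) :
    (3 : ℤ) ∣ ((24 * n + 10) * a' + (96 * n + 40) * m') ∧
    ∀ x y z u : ℤ,
      x = ((24 * n + 10) * a' + (96 * n + 40) * m') / 3 + (-128 * n - 48) * k' +
            (24 * n + 9) * b' + 640 * n ^ 2 + 224 * n →
      y = (3 * n + 3) * a' + (12 * n + 8) * m' + (-48 * n - 21) * k' +
            (9 * n + 4) * b' + 240 * n ^ 2 + 32 * n + 1 →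
      z = (12 * n + 6) * a' + (48 * n + 21) * m' + (-192 * n - 69) * k' +
            (36 * n + 13) * b' + 960 * n ^ 2 + 272 * n + 4 →
      u = a' + 4 * m' - 16 * k' + 3 * b' + 80 * n →
      (3 * x + 4 * y - 4 * z + (12 * n + 3) * u = a' - 48 * n - 12 ∧
       -4 * y + 4 * z - (36 * n + 12) * u = 4 * m' + 12 ∧
       -180 * x - 108 * y + 144 * z + (36 * n + 60) * u = 12 * k' + 192 * n + 468 ∧
       -81 * x - 48 * y + 64 * z + (24 * n + 30) * u = b' + 128 * n + 208) := by
  have hdvd : (3 : ℤ) ∣ ((24 * n + 10) * a' + (96 * n + 40) * m') := by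
    obtain ⟨c, hc⟩ := h
    exact ⟨(8 * n + 3) * a' + (32 * n + 13) * m' + c, by linear_combination hc⟩
  refine ⟨hdvd, ?_⟩
  rintro x y z u hx rfl rfl rfl
  have hdiv := Int.mul_ediv_cancel' hdvd
  subst hx
  refine ⟨?_, ?_, ?_, ?_⟩
  · linear_combination hdiv
  · ring
  · linear_combination -60 * hdiv
  · linear_combination -27 * hdiv
end

section
/- Fix an integer n. For all integers a', m', k', b' with a' + m' ≡ 0 (mod 3), the system of linear equations 3x + 4y − 4z + (12n+3)u = a' + 48n + 12, −4y + 4z − (36n+12)u = 4m' − 12, −180x − 108y + 144z + (36n+60)u = 12k' − 192n − 468, −81x − 48y + 64z + (24n+30)u = b' − 128n − 208 has a unique solution (x, y, z, u) in integers. -/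
/-- The blow-up system for negative `j = −n` has a unique integer solution
`(x, y, z, u)` whenever `a' + m' ≡ 0 (mod 3)`. -/
theorem blowup_system_negative_j (n : ℤ) (a' m' k' b' : ℤ)
    (h : (3 : ℤ) ∣ (a' + m')) :
    ∃! w : ℤ × ℤ × ℤ × ℤ,
      3 * w.1 + 4 * w.2.1 - 4 * w.2.2.1 + (12 * n + 3) * w.2.2.2 =
        a' + 48 * n + 12 ∧
      -4 * w.2.1 + 4 * w.2.2.1 - (36 * n + 12) * w.2.2.2 = 4 * m' - 12 ∧
      -180 * w.1 - 108 * w.2.1 + 144 * w.2.2.1 + (36 * n + 60) * w.2.2.2 =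
        12 * k' - 192 * n - 468 ∧
      -81 * w.1 - 48 * w.2.1 + 64 * w.2.2.1 + (24 * n + 30) * w.2.2.2 =
        b' - 128 * n - 208 := by
  obtain ⟨t, ht⟩ := h
  obtain rfl : a' = 3 * t - m' := by linarith
  -- Eliminating `x` and `z` leaves a unimodular system in `y` and `u` with right-hand sides `r, s`.
  obtain ⟨r, hr⟩ : ∃ r, r = k' + 224 * n - 3 + 3 * m' + 15 * t := ⟨_, rfl⟩
  obtain ⟨s, hs⟩ : ∃ s, s = b' + 1168 * n - 16 + 17 * m' + 81 * t := ⟨_, rfl⟩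
  obtain ⟨u, hu⟩ : ∃ u, u = 3 * s - 16 * r := ⟨_, rfl⟩
  obtain ⟨y, hy⟩ : ∃ y, y = (9 * n + 4) * s - (48 * n + 21) * r := ⟨_, rfl⟩
  refine ⟨((8 * n + 3) * u + t + m' + 16 * n, y, y + (9 * n + 3) * u + m' - 3, u), ?_, ?_⟩
  · subst hu hy hr hs
    refine ⟨?_, ?_, ?_, ?_⟩ <;> ring
  · rintro ⟨x', y', z', u'⟩ ⟨h₁, h₂, h₃, h₄⟩
    dsimp only at h₁ h₂ h₃ h₄
    have hx : x' = (8 * n + 3) * u' + t + m' + 16 * n := by linarith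
    have hz : z' = y' + (9 * n + 3) * u' + m' - 3 := by linarith
    have hr' : 3 * y' - (9 * n + 4) * u' = r := by subst hx hz hr; linarith
    have hs' : 16 * y' - (48 * n + 21) * u' = s := by subst hx hz hs; linarith
    obtain rfl : u' = u := by rw [hu]; linear_combination 3 * hs' - 16 * hr'
    obtain rfl : y' = y := by
      rw [hy]; linear_combination (9 * n + 4) * hs' - (48 * n + 21) * hr'
    rw [hx, hz]
end
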